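/- Let X be a standard Borel space, ζ a Borel probability measure on X, and let Y¹ and Y² be nonempty compact metric spaces. Let μ and ν be information structures on X × Y¹ × Y², each satisfying Assumption 2.1. If μ is better for the maximizer than ν, i.e., V*(μ) ≥ V*(ν) for every game in the class G̃ (nonempty compact metric action spaces U¹, U² and bounded jointly measurable cost c : X × U¹ × U² → ℝ continuous in (u¹,u²) for every x), then there exist Markov kernels κ¹ from Y¹ to Y¹ and κ² from Y² to Y² such that κ¹ν = κ²μ as measures on X × Y¹ × Y². -/

import Mathlib

open MeasureTheory ProbabilityTheory
open MeasureTheory ProbabilityTheory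

/-- The value `V*(P)` of the zero-sum game with information structure `P` and cost `c`:
the infimum over the minimizer's randomized policies (Markov kernels from `Y₁` to `U₁`) of
the supremum over the maximizer's randomized policies (Markov kernels from `Y₂` to `U₂`)
of the expected cost. -/
noncomputable def gameValue {X Y₁ Y₂ U₁ U₂ : Type*}
    [MeasurableSpace X] [MeasurableSpace Y₁] [MeasurableSpace Y₂]
    [MeasurableSpace U₁] [MeasurableSpace U₂]
    (P : Measure (X × Y₁ × Y₂)) (c : X → U₁ → U₂ → ℝ) : ℝ :=
  ⨅ γ₁ : {κ : Kernel Y₁ U₁ // IsMarkovKernel κ},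
    ⨆ γ₂ : {κ : Kernel Y₂ U₂ // IsMarkovKernel κ},
      ∫ p : X × Y₁ × Y₂, ∫ u₁, ∫ u₂, c p.1 u₁ u₂ ∂(γ₂.1 p.2.2) ∂(γ₁.1 p.2.1) ∂P

open Filter Topology
open scoped BoundedContinuousFunction

section KernelIntegral

variable {Ω Y U : Type*} [MeasurableSpace Ω] [MeasurableSpace Y]
  [TopologicalSpace U] [MeasurableSpace U] [BorelSpace U]

lemma measurable_integral_kernel_bcf (κ : Kernel Y U) (g : U →ᵇ ℝ) :
    Measurable fun y => ∫ u, g u ∂κ y :=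
  (StronglyMeasurable.integral_kernel g.continuous.measurable.stronglyMeasurable).measurable

lemma norm_integral_kernel_bcf_le (κ : Kernel Y U) [IsMarkovKernel κ] (g : U →ᵇ ℝ) (y : Y) :
    ‖∫ u, g u ∂κ y‖ ≤ ‖g‖ :=
  g.norm_integral_le_norm (κ y)

/-- Convex combinations of Markov kernels, seen through integrals of bounded continuous
functions. -/
lemma exists_markovKernel_integral_eq_convexComb (κ η : Kernel Y U) [IsMarkovKernel κ]
    [IsMarkovKernel η] {a b : ℝ} (ha : 0 ≤ a) (hb : 0 ≤ b) (hab : a + b = 1) :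
    ∃ θ : Kernel Y U, IsMarkovKernel θ ∧ ∀ (g : U →ᵇ ℝ) (y : Y),
      ∫ u, g u ∂θ y = a * ∫ u, g u ∂κ y + b * ∫ u, g u ∂η y := by
  let θ : Kernel Y U :=
    { toFun := fun y => ENNReal.ofReal a • κ y + ENNReal.ofReal b • η y
      measurable' := by
        refine Measure.measurable_of_measurable_coe _ fun s hs => ?_
        simp only [Measure.coe_add, Measure.coe_smul, Pi.add_apply, Pi.smul_apply, smul_eq_mul]
        exact ((κ.measurable_coe hs).const_mul _).add ((η.measurable_coe hs).const_mul _) }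
  have hθ : ∀ y, θ y = ENNReal.ofReal a • κ y + ENNReal.ofReal b • η y := fun _ => rfl
  refine ⟨θ, ⟨fun y => ⟨?_⟩⟩, fun g y => ?_⟩
  · simp [hθ, ← ENNReal.ofReal_add ha hb, hab]
  · rw [hθ, integral_add_measure
      ((g.integrable (κ y)).smul_measure ENNReal.ofReal_ne_top)
      ((g.integrable (η y)).smul_measure ENNReal.ofReal_ne_top),
      integral_smul_measure, integral_smul_measure, ENNReal.toReal_ofReal ha,
      ENNReal.toReal_ofReal hb, smul_eq_mul, smul_eq_mul]

lemma integrable_mul_integral_kernel_bcf {P : Measure Ω} {F : Ω → ℝ} (hF : Integrable F P)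
    {φ : Ω → Y} (hφ : Measurable φ) (κ : Kernel Y U) [IsMarkovKernel κ] (g : U →ᵇ ℝ) :
    Integrable (fun ω => F ω * ∫ u, g u ∂κ (φ ω)) P :=
  hF.mul_bdd ((measurable_integral_kernel_bcf κ g).comp hφ).aestronglyMeasurable
    (Eventually.of_forall fun ω => norm_integral_kernel_bcf_le κ g (φ ω))

end KernelIntegral

section Factor

variable {Ω Y : Type*} [MeasurableSpace Ω] [MeasurableSpace Y]

/-- Integrating `F` against functions of `φ` only sees a density on the target of `φ`. -/
lemma exists_integrable_map_integral_mul_comp_eq (P : Measure Ω) [IsProbabilityMeasure P]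
    {φ : Ω → Y} (hφ : Measurable φ) {F : Ω → ℝ} (hF : Integrable F P) :
    ∃ w : Y → ℝ, Integrable w (P.map φ) ∧ ∀ G : Y → ℝ, Measurable G →
      (∃ C, ∀ y, ‖G y‖ ≤ C) → ∫ ω, F ω * G (φ ω) ∂P = ∫ y, w y * G y ∂(P.map φ) := by
  have hle := hφ.comap_le
  obtain ⟨w, hw, hwφ⟩ := (stronglyMeasurable_condExp (μ := P) (f := F)
    (m := MeasurableSpace.comap φ inferInstance)).exists_eq_measurable_comp
  refine ⟨w, ?_, fun G hG ⟨C, hC⟩ => ?_⟩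
  · rw [integrable_map_measure hw.aestronglyMeasurable hφ.aemeasurable, ← hwφ]
    exact integrable_condExp
  · have hGm : StronglyMeasurable[MeasurableSpace.comap φ inferInstance] (G ∘ φ) :=
      (hG.comp (comap_measurable φ)).stronglyMeasurable
    have hFG : Integrable (F * (G ∘ φ)) P :=
      hF.mul_bdd (hG.comp hφ).aestronglyMeasurable (Eventually.of_forall fun ω => hC (φ ω))
    have h := condExp_mul_of_stronglyMeasurable_right hGm hFG hF
    have hwG : AEStronglyMeasurable (fun y => w y * G y) (P.map φ) :=
      (hw.mul hG.stronglyMeasurable).aestronglyMeasurable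
    rw [integral_map hφ.aemeasurable hwG]
    calc ∫ ω, F ω * G (φ ω) ∂P
        = ∫ ω, (P[F * (G ∘ φ) | MeasurableSpace.comap φ inferInstance]) ω ∂P :=
          (integral_condExp hle).symm
      _ = ∫ ω, w (φ ω) * G (φ ω) ∂P := by
          refine integral_congr_ae (h.trans ?_)
          rw [hwφ]
          rfl

end Factor

section Compactness

variable {Y U : Type*} [MetricSpace Y] [CompactSpace Y] [MeasurableSpace Y] [BorelSpace Y]
  [MetricSpace U] [CompactSpace U] [Nonempty U] [MeasurableSpace U] [BorelSpace U]

/-- Compactness of Markov kernels for the topology of Young measures, in ultrafilter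
form. -/
lemma exists_markovKernel_tendsto_ultrafilter {ι : Type*} (l : Ultrafilter ι) (α : Measure Y)
    [IsProbabilityMeasure α] (κ : ι → Kernel Y U) (hκ : ∀ i, IsMarkovKernel (κ i)) :
    ∃ η : Kernel Y U, IsMarkovKernel η ∧ ∀ (w : Y → ℝ) (_ : Integrable w α) (g : U →ᵇ ℝ),
      Tendsto (fun i => ∫ y, w y * ∫ u, g u ∂κ i y ∂α) l (𝓝 (∫ y, w y * ∫ u, g u ∂η y ∂α)) := by
  let m : ι → ProbabilityMeasure (Y × U) := fun i => ⟨α ⊗ₘ κ i, inferInstance⟩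
  obtain ⟨ρ, hρ⟩ : ∃ ρ, Tendsto m l (𝓝 ρ) := ⟨(l.map m).lim, (l.map m).le_nhds_lim⟩
  rw [ProbabilityMeasure.tendsto_iff_forall_integral_tendsto] at hρ
  have hfst : (ρ : Measure (Y × U)).fst = α := by
    refine ext_of_forall_integral_eq_of_IsFiniteMeasure fun f => ?_
    have h := hρ (f.compContinuous ⟨Prod.fst, continuous_fst⟩)
    have hconst : ∀ i, ∫ z, (f.compContinuous ⟨Prod.fst, continuous_fst⟩) z ∂(m i : Measure (Y × U))
        = ∫ y, f y ∂α := fun i => by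
      change ∫ z, _ ∂(α ⊗ₘ κ i) = _
      rw [Measure.integral_compProd (BoundedContinuousFunction.integrable _ _)]
      simp
    simp only [hconst] at h
    rw [Measure.fst, integral_map measurable_fst.aemeasurable
      f.continuous.measurable.aestronglyMeasurable]
    exact tendsto_nhds_unique h tendsto_const_nhds |>.symm ▸ rfl
  refine ⟨(ρ : Measure (Y × U)).condKernel, inferInstance, fun w hw g => ?_⟩
  set η := (ρ : Measure (Y × U)).condKernel
  have hdis : α ⊗ₘ η = ρ := by rw [← hfst]; exact Measure.disintegrate _ _
  have hbc : ∀ f : Y →ᵇ ℝ, Tendsto (fun i => ∫ y, f y * ∫ u, g u ∂κ i y ∂α) l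
      (𝓝 (∫ y, f y * ∫ u, g u ∂η y ∂α)) := fun f => by
    let F : (Y × U) →ᵇ ℝ := f.compContinuous ⟨Prod.fst, continuous_fst⟩ *
      g.compContinuous ⟨Prod.snd, continuous_snd⟩
    have key : ∀ (θ : Kernel Y U) [IsMarkovKernel θ],
        ∫ z, F z ∂(α ⊗ₘ θ) = ∫ y, f y * ∫ u, g u ∂θ y ∂α := fun θ _ => by
      rw [Measure.integral_compProd (F.integrable _)]
      simp [F, integral_const_mul]
    have h := hρ F
    rw [← hdis, key] at h
    simpa only [m, ProbabilityMeasure.coe_mk, key] using h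
  have happrox : ∀ (f : Y →ᵇ ℝ) (θ : Kernel Y U) [IsMarkovKernel θ],
      |∫ y, w y * ∫ u, g u ∂θ y ∂α - ∫ y, f y * ∫ u, g u ∂θ y ∂α| ≤
        (∫ y, ‖w y - f y‖ ∂α) * ‖g‖ := fun f θ _ => by
    have hwi := integrable_mul_integral_kernel_bcf hw measurable_id θ g
    have hfi := integrable_mul_integral_kernel_bcf (f.integrable α) measurable_id θ g
    simp only [id] at hwi hfi
    rw [← integral_sub hwi hfi, ← integral_mul_const]
    rw [← Real.norm_eq_abs]
    refine norm_integral_le_of_norm_le ((hw.sub (f.integrable α)).norm.mul_const _)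
      (Eventually.of_forall fun y => ?_)
    rw [← sub_mul, norm_mul]
    gcongr
    exact norm_integral_kernel_bcf_le θ g y
  rw [Metric.tendsto_nhds]
  intro ε hε
  obtain ⟨f, hf, -⟩ := hw.exists_boundedContinuous_integral_sub_le
    (show 0 < ε / (4 * (‖g‖ + 1)) by positivity)
  have hbound : (∫ y, ‖w y - f y‖ ∂α) * ‖g‖ ≤ ε / 4 := by
    calc _ ≤ ε / (4 * (‖g‖ + 1)) * (‖g‖ + 1) := by gcongr; linarith
      _ = ε / 4 := by field_simp
  filter_upwards [Metric.tendsto_nhds.1 (hbc f) (ε / 4) (by positivity)] with i hi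
  have h1 := abs_le.1 ((happrox f (κ i)).trans hbound)
  have h2 := abs_le.1 ((happrox f η).trans hbound)
  rw [Real.dist_eq, abs_lt] at hi ⊢
  constructor <;> linarith [h1.1, h1.2, h2.1, h2.2, hi.1, hi.2]

lemma exists_markovKernel_tendsto_integral_mul {Ω ι : Type*} [MeasurableSpace Ω]
    (l : Ultrafilter ι) (P : Measure Ω) [IsProbabilityMeasure P] {φ : Ω → Y} (hφ : Measurable φ)
    (κ : ι → Kernel Y U) (hκ : ∀ i, IsMarkovKernel (κ i)) :
    ∃ η : Kernel Y U, IsMarkovKernel η ∧ ∀ (F : Ω → ℝ) (_ : Integrable F P) (g : U →ᵇ ℝ),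
      Tendsto (fun i => ∫ ω, F ω * ∫ u, g u ∂κ i (φ ω) ∂P) l
        (𝓝 (∫ ω, F ω * ∫ u, g u ∂η (φ ω) ∂P)) := by
  have := Measure.isProbabilityMeasure_map (μ := P) hφ.aemeasurable
  obtain ⟨η, hη, h⟩ := exists_markovKernel_tendsto_ultrafilter l (P.map φ) κ hκ
  refine ⟨η, hη, fun F hF g => ?_⟩
  obtain ⟨w, hw, hFw⟩ := exists_integrable_map_integral_mul_comp_eq P hφ hF
  have key : ∀ (θ : Kernel Y U) [IsMarkovKernel θ], ∫ ω, F ω * ∫ u, g u ∂θ (φ ω) ∂P =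
      ∫ y, w y * ∫ u, g u ∂θ y ∂(P.map φ) := fun θ _ =>
    hFw _ (measurable_integral_kernel_bcf θ g) ⟨‖g‖, norm_integral_kernel_bcf_le θ g⟩
  simpa only [key] using h w hw g

end Compactness

/-- If no linear functional is positive and bounded away from zero on a convex set, the set
contains arbitrarily small vectors. -/
lemma Convex.exists_forall_abs_lt_of_forall_linear {ι : Type*} [Fintype ι] {S : Set (ι → ℝ)}
    (hS : Convex ℝ S) (h : ∀ (a : ι → ℝ) (ε : ℝ), 0 < ε → ∃ s ∈ S, ∑ i, a i * s i < ε)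
    {ε : ℝ} (hε : 0 < ε) : ∃ s ∈ S, ∀ i, |s i| < ε := by
  classical
  have h0 : (0 : ι → ℝ) ∈ closure S := by
    by_contra h0
    obtain ⟨f, u, hu, hfS⟩ := geometric_hahn_banach_point_closed hS.closure isClosed_closure h0
    rw [map_zero] at hu
    obtain ⟨s, hs, hlt⟩ := h (fun i => f fun j => if i = j then 1 else 0) u hu
    have hfs := hfS s (subset_closure hs)
    have hsum := LinearMap.pi_apply_eq_sum_univ (f : (ι → ℝ) →ₗ[ℝ] ℝ) s
    simp only [smul_eq_mul, ContinuousLinearMap.coe_coe] at hsum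
    simp only [mul_comm (f _)] at hlt
    linarith
  obtain ⟨s, hs, hd⟩ := Metric.mem_closure_iff.1 h0 ε hε
  exact ⟨s, hs, fun i => by simpa using (dist_pi_lt_iff hε).1 hd i⟩

/-- The expected cost under `P` when the players use the randomized policies `γ₁` and `γ₂`. -/
noncomputable def expectedCost {X Y₁ Y₂ U₁ U₂ : Type*}
    [MeasurableSpace X] [MeasurableSpace Y₁] [MeasurableSpace Y₂]
    [MeasurableSpace U₁] [MeasurableSpace U₂]
    (P : Measure (X × Y₁ × Y₂)) (c : X → U₁ → U₂ → ℝ)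
    (γ₁ : Kernel Y₁ U₁) (γ₂ : Kernel Y₂ U₂) : ℝ :=
  ∫ p : X × Y₁ × Y₂, ∫ u₁, ∫ u₂, c p.1 u₁ u₂ ∂(γ₂ p.2.2) ∂(γ₁ p.2.1) ∂P

section Game

variable {X Y₁ Y₂ U₁ U₂ : Type*}
  [MeasurableSpace X] [MeasurableSpace Y₁] [MeasurableSpace Y₂]
  [MeasurableSpace U₁] [MeasurableSpace U₂]

lemma norm_integral_le_of_forall_norm_le {Z : Type*} [MeasurableSpace Z] (m : Measure Z)
    [IsProbabilityMeasure m] {f : Z → ℝ} {M : ℝ} (hf : ∀ z, ‖f z‖ ≤ M) : ‖∫ z, f z ∂m‖ ≤ M := by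
  simpa using norm_integral_le_of_norm_le_const (μ := m) (Eventually.of_forall hf)

lemma abs_expectedCost_le (P : Measure (X × Y₁ × Y₂)) [IsProbabilityMeasure P]
    {c : X → U₁ → U₂ → ℝ} {M : ℝ} (hM : ∀ x u₁ u₂, |c x u₁ u₂| ≤ M)
    (γ₁ : Kernel Y₁ U₁) (γ₂ : Kernel Y₂ U₂) [IsMarkovKernel γ₁] [IsMarkovKernel γ₂] :
    |expectedCost P c γ₁ γ₂| ≤ M := by
  exact norm_integral_le_of_forall_norm_le P fun p => norm_integral_le_of_forall_norm_le _ fun u₁ =>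
    norm_integral_le_of_forall_norm_le _ fun u₂ => hM _ _ _

/-- If the value does not decrease from `ν` to `μ`, then against fixed policies `δ₂` under `ν`
and `δ₁` under `μ` the two players have responses whose costs compare up to `ε`. -/
lemma exists_expectedCost_lt_of_gameValue_le {μ ν : Measure (X × Y₁ × Y₂)}
    [IsProbabilityMeasure μ] [IsProbabilityMeasure ν] {c : X → U₁ → U₂ → ℝ} {M : ℝ}
    (hM : ∀ x u₁ u₂, |c x u₁ u₂| ≤ M) (h : gameValue ν c ≤ gameValue μ c)
    (δ₁ : Kernel Y₁ U₁) (δ₂ : Kernel Y₂ U₂) [IsMarkovKernel δ₁] [IsMarkovKernel δ₂]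
    {ε : ℝ} (hε : 0 < ε) :
    ∃ (γ₁ : Kernel Y₁ U₁) (γ₂ : Kernel Y₂ U₂), IsMarkovKernel γ₁ ∧ IsMarkovKernel γ₂ ∧
      expectedCost ν c γ₁ δ₂ < expectedCost μ c δ₁ γ₂ + ε := by
  have : Nonempty {κ : Kernel Y₁ U₁ // IsMarkovKernel κ} := ⟨⟨δ₁, inferInstance⟩⟩
  have : Nonempty {κ : Kernel Y₂ U₂ // IsMarkovKernel κ} := ⟨⟨δ₂, inferInstance⟩⟩
  have hbdd : ∀ (P : Measure (X × Y₁ × Y₂)) [IsProbabilityMeasure P]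
      (γ₁ : {κ : Kernel Y₁ U₁ // IsMarkovKernel κ}),
      BddAbove (Set.range fun γ₂ : {κ : Kernel Y₂ U₂ // IsMarkovKernel κ} =>
        expectedCost P c γ₁.1 γ₂.1) := fun P _ γ₁ => by
    refine ⟨M, ?_⟩
    rintro _ ⟨γ₂, rfl⟩
    have := γ₁.2
    have := γ₂.2
    exact (abs_le.1 (abs_expectedCost_le P hM γ₁.1 γ₂.1)).2
  have hbddBelow : BddBelow (Set.range fun γ₁ : {κ : Kernel Y₁ U₁ // IsMarkovKernel κ} =>
      ⨆ γ₂ : {κ : Kernel Y₂ U₂ // IsMarkovKernel κ}, expectedCost μ c γ₁.1 γ₂.1) := by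
    refine ⟨-M, ?_⟩
    rintro _ ⟨γ₁, rfl⟩
    have := γ₁.2
    exact (abs_le.1 (abs_expectedCost_le μ hM γ₁.1 δ₂)).1.trans
      (le_ciSup (hbdd μ γ₁) ⟨δ₂, inferInstance⟩)
  have hμ : gameValue μ c ≤ ⨆ γ₂ : {κ : Kernel Y₂ U₂ // IsMarkovKernel κ},
      expectedCost μ c δ₁ γ₂.1 := ciInf_le hbddBelow ⟨δ₁, inferInstance⟩
  obtain ⟨γ₂, hγ₂⟩ := exists_lt_of_lt_ciSup
    (lt_of_lt_of_le (sub_lt_self (gameValue μ c) (half_pos hε)) hμ)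
  obtain ⟨γ₁, hγ₁⟩ := exists_lt_of_ciInf_lt
    (show (⨅ γ₁ : {κ : Kernel Y₁ U₁ // IsMarkovKernel κ},
      ⨆ γ₂ : {κ : Kernel Y₂ U₂ // IsMarkovKernel κ}, expectedCost ν c γ₁.1 γ₂.1) <
        gameValue ν c + ε / 2 from lt_add_of_pos_right _ (half_pos hε))
  have hle := le_ciSup (hbdd ν γ₁) ⟨δ₂, inferInstance⟩
  refine ⟨γ₁.1, γ₂.1, γ₁.2, γ₂.2, ?_⟩
  dsimp only at hle hγ₁ hγ₂
  linarith

end Game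

/-- A compact metric space has a homeomorphic copy in the lowest universe. -/
lemma exists_homeomorph_compact_metricSpace_type (Y : Type*) [MetricSpace Y] [CompactSpace Y]
    [Nonempty Y] :
    ∃ (U : Type) (_ : MetricSpace U) (_ : CompactSpace U) (_ : Nonempty U)
      (_ : MeasurableSpace U) (_ : BorelSpace U), Nonempty (Y ≃ₜ U) := by
  let e := (kuratowskiEmbedding.isometry Y).isometryEquivOnRange.toHomeomorph
  let mU : MeasurableSpace (Set.range (kuratowskiEmbedding Y)) := borel _
  exact ⟨Set.range (kuratowskiEmbedding Y), inferInstance, e.compactSpace,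
    e.symm.surjective.nonempty, mU, ⟨rfl⟩, ⟨e⟩⟩

section Comparison

variable {X Y₁ Y₂ : Type*} [MeasurableSpace X]
  [MetricSpace Y₁] [CompactSpace Y₁] [Nonempty Y₁] [MeasurableSpace Y₁] [BorelSpace Y₁]
  [MetricSpace Y₂] [CompactSpace Y₂] [Nonempty Y₂] [MeasurableSpace Y₂] [BorelSpace Y₂]

/-- `μ` is better for the maximizer than `ν`, over games with compact metric action spaces and
bounded measurable costs that are continuous in the actions. -/
def BetterForMaximizer (μ ν : Measure (X × Y₁ × Y₂)) : Prop :=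
  ∀ (U₁ U₂ : Type) [MetricSpace U₁] [CompactSpace U₁] [Nonempty U₁]
    [MeasurableSpace U₁] [BorelSpace U₁]
    [MetricSpace U₂] [CompactSpace U₂] [Nonempty U₂]
    [MeasurableSpace U₂] [BorelSpace U₂],
    ∀ c : X → U₁ → U₂ → ℝ,
    (∃ M : ℝ, ∀ x u₁ u₂, |c x u₁ u₂| ≤ M) →
    (Measurable fun p : X × U₁ × U₂ => c p.1 p.2.1 p.2.2) →
    (∀ x, Continuous fun q : U₁ × U₂ => c x q.1 q.2) →
    gameValue (U₁ := U₁) (U₂ := U₂) ν c ≤ gameValue (U₁ := U₁) (U₂ := U₂) μ c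

/-- Playing the observation itself as the action: garblings of `ν` by the minimizer and of `μ` by
the maximizer compare on every test function. -/
lemma BetterForMaximizer.exists_integral_lt {μ ν : Measure (X × Y₁ × Y₂)}
    [IsProbabilityMeasure μ] [IsProbabilityMeasure ν] (hbetter : BetterForMaximizer μ ν)
    {f : X → Y₁ → Y₂ → ℝ} {M : ℝ} (hM : ∀ x y₁ y₂, |f x y₁ y₂| ≤ M)
    (hf : Measurable fun p : X × Y₁ × Y₂ => f p.1 p.2.1 p.2.2)
    (hfc : ∀ x, Continuous fun q : Y₁ × Y₂ => f x q.1 q.2) {ε : ℝ} (hε : 0 < ε) :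
    ∃ (κ₁ : Kernel Y₁ Y₁) (κ₂ : Kernel Y₂ Y₂), IsMarkovKernel κ₁ ∧ IsMarkovKernel κ₂ ∧
      ∫ p : X × Y₁ × Y₂, ∫ u, f p.1 u p.2.2 ∂(κ₁ p.2.1) ∂ν <
        ∫ p : X × Y₁ × Y₂, ∫ v, f p.1 p.2.1 v ∂(κ₂ p.2.2) ∂μ + ε := by
  obtain ⟨U₁, _, _, _, _, _, ⟨e₁⟩⟩ := exists_homeomorph_compact_metricSpace_type Y₁
  obtain ⟨U₂, _, _, _, _, _, ⟨e₂⟩⟩ := exists_homeomorph_compact_metricSpace_type Y₂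
  have m₁ : Measurable e₁.symm := e₁.symm.continuous.measurable
  have m₂ : Measurable e₂.symm := e₂.symm.continuous.measurable
  let c : X → U₁ → U₂ → ℝ := fun x u₁ u₂ => f x (e₁.symm u₁) (e₂.symm u₂)
  have hcM : ∀ x u₁ u₂, |c x u₁ u₂| ≤ M := fun x u₁ u₂ => hM _ _ _
  have hval := hbetter U₁ U₂ c ⟨M, hcM⟩
    (hf.comp (measurable_fst.prodMk ((m₁.comp measurable_snd.fst).prodMk
      (m₂.comp measurable_snd.snd))))
    (fun x => (hfc x).comp ((e₁.symm.continuous.comp continuous_fst).prodMk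
      (e₂.symm.continuous.comp continuous_snd)))
  obtain ⟨γ₁, γ₂, hγ₁, hγ₂, hlt⟩ := exists_expectedCost_lt_of_gameValue_le hcM hval
    (Kernel.deterministic e₁ e₁.continuous.measurable)
    (Kernel.deterministic e₂ e₂.continuous.measurable) hε
  refine ⟨γ₁.map e₁.symm, γ₂.map e₂.symm, Kernel.IsMarkovKernel.map _ m₁,
    Kernel.IsMarkovKernel.map _ m₂, ?_⟩
  have hf₁ : ∀ x y₂, Continuous fun u => f x u y₂ := fun x y₂ =>
    (hfc x).comp (continuous_id.prodMk continuous_const)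
  have hf₂ : ∀ x y₁, Continuous fun v => f x y₁ v := fun x y₁ =>
    (hfc x).comp (continuous_const.prodMk continuous_id)
  simp only [expectedCost, Kernel.integral_deterministic, c, Homeomorph.symm_apply_apply] at hlt
  simp only [Kernel.map_apply _ m₁, Kernel.map_apply _ m₂]
  simp_rw [fun (p : X × Y₁ × Y₂) => integral_map (μ := γ₁ p.2.1) m₁.aemeasurable
      (hf₁ p.1 p.2.2).measurable.aestronglyMeasurable,
    fun (p : X × Y₁ × Y₂) => integral_map (μ := γ₂ p.2.2) m₂.aemeasurable
      (hf₂ p.1 p.2.1).measurable.aestronglyMeasurable]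
  exact hlt

end Comparison

lemma exists_markovKernel_integral_mul_eq_convexComb {Ω Y U : Type*} [MeasurableSpace Ω]
    [MeasurableSpace Y] [TopologicalSpace U] [MeasurableSpace U] [BorelSpace U]
    (P : Measure Ω) {φ : Ω → Y} (hφ : Measurable φ) (κ η : Kernel Y U)
    [IsMarkovKernel κ] [IsMarkovKernel η] {a b : ℝ} (ha : 0 ≤ a) (hb : 0 ≤ b) (hab : a + b = 1) :
    ∃ θ : Kernel Y U, IsMarkovKernel θ ∧ ∀ (F : Ω → ℝ) (_ : Integrable F P) (g : U →ᵇ ℝ),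
      ∫ ω, F ω * ∫ u, g u ∂θ (φ ω) ∂P =
        a * ∫ ω, F ω * ∫ u, g u ∂κ (φ ω) ∂P + b * ∫ ω, F ω * ∫ u, g u ∂η (φ ω) ∂P := by
  obtain ⟨θ, hθ, h⟩ := exists_markovKernel_integral_eq_convexComb κ η ha hb hab
  refine ⟨θ, hθ, fun F hF g => ?_⟩
  rw [← integral_const_mul, ← integral_const_mul, ← integral_add
    ((integrable_mul_integral_kernel_bcf hF hφ κ g).const_mul a)
    ((integrable_mul_integral_kernel_bcf hF hφ η g).const_mul b)]
  congr 1 with ω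
  rw [h]
  ring

lemma abs_indicator_one_le {X : Type*} (A : Set X) (x : X) : |A.indicator (1 : X → ℝ) x| ≤ 1 := by
  by_cases h : x ∈ A <;> simp [h]

lemma integrable_indicator_mul_comp {Ω X Y : Type*} [MeasurableSpace Ω] [MeasurableSpace X] [TopologicalSpace Y]
    [MeasurableSpace Y] [BorelSpace Y] (P : Measure Ω) [IsFiniteMeasure P] {A : Set X}
    (hA : MeasurableSet A) {ξ : Ω → X} (hξ : Measurable ξ) {φ : Ω → Y} (hφ : Measurable φ)
    (g : Y →ᵇ ℝ) :
    Integrable (fun ω => A.indicator (1 : X → ℝ) (ξ ω) * g (φ ω)) P := by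
  refine Integrable.of_bound ((((measurable_one.indicator hA).comp hξ).mul
    (g.continuous.measurable.comp hφ)).aestronglyMeasurable) (1 * ‖g‖)
    (Eventually.of_forall fun ω => ?_)
  rw [norm_mul]
  gcongr
  · exact abs_indicator_one_le A _
  · exact g.norm_coe_le_norm _

section TestFunctions

/-- Test functions `(x, y₁, y₂) ↦ 1_A(x) g(y₁) h(y₂)`. -/
abbrev ProductTest (X Y₁ Y₂ : Type*) [MeasurableSpace X] [MetricSpace Y₁] [MetricSpace Y₂] :=
  {A : Set X // MeasurableSet A} × (Y₁ →ᵇ ℝ) × (Y₂ →ᵇ ℝ)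

variable {X Y₁ Y₂ : Type*} [MeasurableSpace X] [MetricSpace Y₁] [MetricSpace Y₂]
  {J : Type*} [Fintype J] (a : J → ℝ) (t : J → ProductTest X Y₁ Y₂)

/-- The linear combination of product test functions with coefficients `a`. -/
noncomputable def testCombination (x : X) (y₁ : Y₁) (y₂ : Y₂) : ℝ :=
  ∑ j, a j * ((t j).1.1.indicator 1 x * (t j).2.1 y₁ * (t j).2.2 y₂)

lemma abs_testCombination_le (x : X) (y₁ : Y₁) (y₂ : Y₂) :
    |testCombination a t x y₁ y₂| ≤ ∑ j, |a j| * (1 * ‖(t j).2.1‖ * ‖(t j).2.2‖) := by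
  refine (Finset.abs_sum_le_sum_abs _ _).trans (Finset.sum_le_sum fun j _ => ?_)
  rw [abs_mul, abs_mul, abs_mul]
  gcongr
  · exact abs_indicator_one_le _ _
  · exact (t j).2.1.norm_coe_le_norm _
  · exact (t j).2.2.norm_coe_le_norm _

lemma measurable_testCombination [MeasurableSpace Y₁] [BorelSpace Y₁] [MeasurableSpace Y₂]
    [BorelSpace Y₂] :
    Measurable fun p : X × Y₁ × Y₂ => testCombination a t p.1 p.2.1 p.2.2 :=
  Finset.measurable_sum _ fun j _ => ((((measurable_one.indicator (t j).1.2).comp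
    measurable_fst).mul ((t j).2.1.continuous.measurable.comp measurable_snd.fst)).mul
    ((t j).2.2.continuous.measurable.comp measurable_snd.snd)).const_mul _

lemma continuous_testCombination (x : X) :
    Continuous fun q : Y₁ × Y₂ => testCombination a t x q.1 q.2 := by
  unfold testCombination
  fun_prop

end TestFunctions

section Pairing

variable {X Y₁ Y₂ : Type*} [MeasurableSpace X]
  [MetricSpace Y₁] [MeasurableSpace Y₁] [MetricSpace Y₂] [MeasurableSpace Y₂]

/-- The integral of a product test function against the garbling of `ν` by the minimizer. -/
noncomputable def garbledPairing₁ (ν : Measure (X × Y₁ × Y₂)) (κ : Kernel Y₁ Y₁)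
    (t : ProductTest X Y₁ Y₂) : ℝ :=
  ∫ p : X × Y₁ × Y₂, (t.1.1.indicator 1 p.1 * t.2.2 p.2.2) * ∫ u, t.2.1 u ∂κ p.2.1 ∂ν

/-- The integral of a product test function against the garbling of `μ` by the maximizer. -/
noncomputable def garbledPairing₂ (μ : Measure (X × Y₁ × Y₂)) (κ : Kernel Y₂ Y₂)
    (t : ProductTest X Y₁ Y₂) : ℝ :=
  ∫ p : X × Y₁ × Y₂, (t.1.1.indicator 1 p.1 * t.2.1 p.2.1) * ∫ v, t.2.2 v ∂κ p.2.2 ∂μ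

lemma integrable_garbledPairing₁ [BorelSpace Y₂] (ν : Measure (X × Y₁ × Y₂)) [IsFiniteMeasure ν]
    (t : ProductTest X Y₁ Y₂) :
    Integrable (fun p : X × Y₁ × Y₂ => t.1.1.indicator (1 : X → ℝ) p.1 * t.2.2 p.2.2) ν :=
  integrable_indicator_mul_comp ν t.1.2 measurable_fst measurable_snd.snd _

lemma integrable_garbledPairing₂ [BorelSpace Y₁] (μ : Measure (X × Y₁ × Y₂)) [IsFiniteMeasure μ]
    (t : ProductTest X Y₁ Y₂) :
    Integrable (fun p : X × Y₁ × Y₂ => t.1.1.indicator (1 : X → ℝ) p.1 * t.2.1 p.2.1) μ :=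
  integrable_indicator_mul_comp μ t.1.2 measurable_fst measurable_snd.fst _

variable [BorelSpace Y₁] [BorelSpace Y₂] {J : Type*} [Fintype J] (a : J → ℝ)
  (t : J → ProductTest X Y₁ Y₂)

lemma integral_testCombination_eq_sum_garbledPairing₁ (ν : Measure (X × Y₁ × Y₂))
    [IsFiniteMeasure ν] (κ : Kernel Y₁ Y₁) [IsMarkovKernel κ] :
    ∫ p : X × Y₁ × Y₂, ∫ u, testCombination a t p.1 u p.2.2 ∂κ p.2.1 ∂ν =
      ∑ j, a j * garbledPairing₁ ν κ (t j) := by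
  have inner : ∀ p : X × Y₁ × Y₂, ∫ u, testCombination a t p.1 u p.2.2 ∂κ p.2.1 =
      ∑ j, a j * (((t j).1.1.indicator 1 p.1 * (t j).2.2 p.2.2) * ∫ u, (t j).2.1 u ∂κ p.2.1) := by
    intro p
    unfold testCombination
    rw [integral_finsetSum _ fun j _ =>
      ((((t j).2.1.integrable (κ p.2.1)).const_mul _).mul_const _).const_mul _]
    refine Finset.sum_congr rfl fun j _ => ?_
    rw [integral_const_mul, integral_mul_const, integral_const_mul]
    ring
  simp_rw [inner]
  rw [integral_finsetSum _ fun j _ => (integrable_mul_integral_kernel_bcf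
    (integrable_garbledPairing₁ ν (t j)) measurable_snd.fst κ (t j).2.1).const_mul _]
  exact Finset.sum_congr rfl fun j _ => integral_const_mul _ _

lemma integral_testCombination_eq_sum_garbledPairing₂ (μ : Measure (X × Y₁ × Y₂))
    [IsFiniteMeasure μ] (κ : Kernel Y₂ Y₂) [IsMarkovKernel κ] :
    ∫ p : X × Y₁ × Y₂, ∫ v, testCombination a t p.1 p.2.1 v ∂κ p.2.2 ∂μ =
      ∑ j, a j * garbledPairing₂ μ κ (t j) := by
  have inner : ∀ p : X × Y₁ × Y₂, ∫ v, testCombination a t p.1 p.2.1 v ∂κ p.2.2 =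
      ∑ j, a j * (((t j).1.1.indicator 1 p.1 * (t j).2.1 p.2.1) * ∫ v, (t j).2.2 v ∂κ p.2.2) := by
    intro p
    unfold testCombination
    rw [integral_finsetSum _ fun j _ =>
      (((t j).2.2.integrable (κ p.2.2)).const_mul _).const_mul _]
    exact Finset.sum_congr rfl fun j _ => by rw [integral_const_mul, integral_const_mul]
  simp_rw [inner]
  rw [integral_finsetSum _ fun j _ => (integrable_mul_integral_kernel_bcf
    (integrable_garbledPairing₂ μ (t j)) measurable_snd.snd κ (t j).2.2).const_mul _]
  exact Finset.sum_congr rfl fun j _ => integral_const_mul _ _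

lemma measurable_bcf_mul_bcf (g : Y₁ →ᵇ ℝ) (h : Y₂ →ᵇ ℝ) :
    Measurable fun q : Y₁ × Y₂ => g q.1 * h q.2 :=
  (g.continuous.measurable.comp measurable_fst).mul (h.continuous.measurable.comp measurable_snd)

lemma integrable_bcf_mul_bcf_comp {Z : Type*} [MeasurableSpace Z] (m : Measure Z)
    [IsFiniteMeasure m] {f : Z → Y₁ × Y₂} (hf : Measurable f) (g : Y₁ →ᵇ ℝ) (h : Y₂ →ᵇ ℝ) :
    Integrable (fun z => g (f z).1 * h (f z).2) m := by
  refine Integrable.of_bound ((measurable_bcf_mul_bcf g h).comp hf).aestronglyMeasurable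
    (‖g‖ * ‖h‖) (Eventually.of_forall fun z => ?_)
  rw [norm_mul]
  gcongr
  exacts [g.norm_coe_le_norm _, h.norm_coe_le_norm _]

/-- Garblings with equal pairings agree on measurable rectangles. -/
lemma setLIntegral_eq_of_garbledPairing_eq {μ ν : Measure (X × Y₁ × Y₂)} [IsFiniteMeasure μ]
    [IsFiniteMeasure ν] {κ₁ : Kernel Y₁ Y₁} {κ₂ : Kernel Y₂ Y₂} [IsMarkovKernel κ₁]
    [IsMarkovKernel κ₂]
    (h : ∀ t : ProductTest X Y₁ Y₂, garbledPairing₁ ν κ₁ t = garbledPairing₂ μ κ₂ t)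
    {A : Set X} {B : Set Y₁} {C : Set Y₂}
    (hA : MeasurableSet A) (hB : MeasurableSet B) (hC : MeasurableSet C) :
    (∫⁻ p in A ×ˢ ((Set.univ : Set Y₁) ×ˢ C), κ₁ p.2.1 B ∂ν) =
      ∫⁻ p in A ×ˢ (B ×ˢ (Set.univ : Set Y₂)), κ₂ p.2.2 C ∂μ := by
  have hAm : MeasurableSet (Prod.fst ⁻¹' A : Set (X × Y₁ × Y₂)) := measurable_fst hA
  let η₁ : Kernel (X × Y₁ × Y₂) Y₁ := κ₁.comap (fun p => p.2.1) measurable_snd.fst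
  let η₂ : Kernel (X × Y₁ × Y₂) Y₂ := κ₂.comap (fun p => p.2.2) measurable_snd.snd
  let f₁ : (X × Y₁ × Y₂) × Y₁ → Y₁ × Y₂ := fun q => (q.2, q.1.2.2)
  let f₂ : (X × Y₁ × Y₂) × Y₂ → Y₁ × Y₂ := fun q => (q.1.2.1, q.2)
  have hf₁ : Measurable f₁ := measurable_snd.prodMk measurable_fst.snd.snd
  have hf₂ : Measurable f₂ := measurable_fst.snd.fst.prodMk measurable_snd
  let ρ₁ : Measure (Y₁ × Y₂) := ((ν.restrict (Prod.fst ⁻¹' A)) ⊗ₘ η₁).map f₁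
  let ρ₂ : Measure (Y₁ × Y₂) := ((μ.restrict (Prod.fst ⁻¹' A)) ⊗ₘ η₂).map f₂
  have hρ : ρ₁ = ρ₂ := by
    refine Measure.ext_of_integral_mul_boundedContinuousFunction fun g k => ?_
    have hk := h (⟨A, hA⟩, g, k)
    have h₁ : ∫ q, g q.1 * k q.2 ∂ρ₁ = garbledPairing₁ ν κ₁ (⟨A, hA⟩, g, k) := by
      rw [integral_map hf₁.aemeasurable (measurable_bcf_mul_bcf g k).aestronglyMeasurable,
        Measure.integral_compProd (integrable_bcf_mul_bcf_comp _ hf₁ g k),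
        ← integral_indicator hAm]
      unfold garbledPairing₁
      congr 1 with p
      by_cases hp : p.1 ∈ A <;> simp [hp, f₁, η₁, integral_mul_const, mul_comm]
    have h₂ : ∫ q, g q.1 * k q.2 ∂ρ₂ = garbledPairing₂ μ κ₂ (⟨A, hA⟩, g, k) := by
      rw [integral_map hf₂.aemeasurable (measurable_bcf_mul_bcf g k).aestronglyMeasurable,
        Measure.integral_compProd (integrable_bcf_mul_bcf_comp _ hf₂ g k),
        ← integral_indicator hAm]
      unfold garbledPairing₂
      congr 1 with p
      by_cases hp : p.1 ∈ A <;> simp [hp, f₂, η₂, integral_const_mul]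
    rw [h₁, h₂, hk]
  have hC' : MeasurableSet {p : X × Y₁ × Y₂ | p.2.2 ∈ C} := measurable_snd.snd hC
  have hB' : MeasurableSet {p : X × Y₁ × Y₂ | p.2.1 ∈ B} := measurable_snd.fst hB
  have hset₁ : f₁ ⁻¹' (B ×ˢ C) = {p : X × Y₁ × Y₂ | p.2.2 ∈ C} ×ˢ B := by
    ext q
    simp [f₁, and_comm]
  have hset₂ : f₂ ⁻¹' (B ×ˢ C) = {p : X × Y₁ × Y₂ | p.2.1 ∈ B} ×ˢ C := by
    ext q
    simp [f₂]
  have hBC := congrArg (fun ρ : Measure (Y₁ × Y₂) => ρ (B ×ˢ C)) hρ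
  dsimp only [ρ₁, ρ₂] at hBC
  rw [Measure.map_apply hf₁ (hB.prod hC), Measure.map_apply hf₂ (hB.prod hC), hset₁, hset₂,
    Measure.compProd_apply_prod hC' hB, Measure.compProd_apply_prod hB' hC,
    Measure.restrict_restrict hC', Measure.restrict_restrict hB'] at hBC
  have hA₁ : A ×ˢ ((Set.univ : Set Y₁) ×ˢ C) = {p | p.2.2 ∈ C} ∩ Prod.fst ⁻¹' A := by
    ext p
    simp [and_comm]
  have hA₂ : A ×ˢ (B ×ˢ (Set.univ : Set Y₂)) = {p | p.2.1 ∈ B} ∩ Prod.fst ⁻¹' A := by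
    ext p
    simp [and_comm]
  rw [hA₁, hA₂]
  exact hBC

end Pairing

section Separation

variable {X Y₁ Y₂ : Type*} [MeasurableSpace X]
  [MetricSpace Y₁] [CompactSpace Y₁] [Nonempty Y₁] [MeasurableSpace Y₁] [BorelSpace Y₁]
  [MetricSpace Y₂] [CompactSpace Y₂] [Nonempty Y₂] [MeasurableSpace Y₂] [BorelSpace Y₂]
  {μ ν : Measure (X × Y₁ × Y₂)} [IsProbabilityMeasure μ] [IsProbabilityMeasure ν]

lemma BetterForMaximizer.exists_forall_abs_garbledPairing_sub_lt (hbetter : BetterForMaximizer μ ν)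
    {J : Type*} [Fintype J] (t : J → ProductTest X Y₁ Y₂) {ε : ℝ} (hε : 0 < ε) :
    ∃ (κ₁ : Kernel Y₁ Y₁) (κ₂ : Kernel Y₂ Y₂), IsMarkovKernel κ₁ ∧ IsMarkovKernel κ₂ ∧
      ∀ j, |garbledPairing₁ ν κ₁ (t j) - garbledPairing₂ μ κ₂ (t j)| < ε := by
  let S : Set (J → ℝ) := {s | ∃ (κ₁ : Kernel Y₁ Y₁) (κ₂ : Kernel Y₂ Y₂), IsMarkovKernel κ₁ ∧
    IsMarkovKernel κ₂ ∧ s = fun j => garbledPairing₁ ν κ₁ (t j) - garbledPairing₂ μ κ₂ (t j)}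
  have hconv : Convex ℝ S := by
    rintro _ ⟨κ₁, κ₂, hκ₁, hκ₂, rfl⟩ _ ⟨η₁, η₂, hη₁, hη₂, rfl⟩ a b ha hb hab
    obtain ⟨θ₁, hθ₁, h₁⟩ := exists_markovKernel_integral_mul_eq_convexComb ν
      (φ := fun p => p.2.1) measurable_snd.fst κ₁ η₁ ha hb hab
    obtain ⟨θ₂, hθ₂, h₂⟩ := exists_markovKernel_integral_mul_eq_convexComb μ
      (φ := fun p => p.2.2) measurable_snd.snd κ₂ η₂ ha hb hab
    refine ⟨θ₁, θ₂, hθ₁, hθ₂, funext fun j => ?_⟩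
    have e₁ := h₁ _ (integrable_garbledPairing₁ ν (t j)) (t j).2.1
    have e₂ := h₂ _ (integrable_garbledPairing₂ μ (t j)) (t j).2.2
    simp only [Pi.add_apply, Pi.smul_apply, smul_eq_mul, garbledPairing₁, garbledPairing₂, e₁, e₂]
    ring
  obtain ⟨_, ⟨κ₁, κ₂, hκ₁, hκ₂, rfl⟩, h⟩ := hconv.exists_forall_abs_lt_of_forall_linear
    (fun a δ hδ => by
      obtain ⟨κ₁, κ₂, hκ₁, hκ₂, hlt⟩ := hbetter.exists_integral_lt (abs_testCombination_le a t)
        (measurable_testCombination a t) (continuous_testCombination a t) hδ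
      rw [integral_testCombination_eq_sum_garbledPairing₁,
        integral_testCombination_eq_sum_garbledPairing₂] at hlt
      refine ⟨_, ⟨κ₁, κ₂, hκ₁, hκ₂, rfl⟩, ?_⟩
      simp only [mul_sub, Finset.sum_sub_distrib]
      linarith) hε
  exact ⟨κ₁, κ₂, hκ₁, hκ₂, h⟩

lemma BetterForMaximizer.exists_garbledPairing_eq (hbetter : BetterForMaximizer μ ν) :
    ∃ (κ₁ : Kernel Y₁ Y₁) (κ₂ : Kernel Y₂ Y₂), IsMarkovKernel κ₁ ∧ IsMarkovKernel κ₂ ∧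
      ∀ t, garbledPairing₁ ν κ₁ t = garbledPairing₂ μ κ₂ t := by
  classical
  choose κ₁ κ₂ hκ₁ hκ₂ h using fun i : Finset (ProductTest X Y₁ Y₂) × ℕ =>
    hbetter.exists_forall_abs_garbledPairing_sub_lt (fun j : i.1 => j.1)
      (Nat.one_div_pos_of_nat (α := ℝ) (n := i.2))
  let l : Ultrafilter (Finset (ProductTest X Y₁ Y₂) × ℕ) := Ultrafilter.of atTop
  obtain ⟨η₁, hη₁, h₁⟩ := exists_markovKernel_tendsto_integral_mul l ν
    (φ := fun p => p.2.1) measurable_snd.fst κ₁ hκ₁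
  obtain ⟨η₂, hη₂, h₂⟩ := exists_markovKernel_tendsto_integral_mul l μ
    (φ := fun p => p.2.2) measurable_snd.snd κ₂ hκ₂
  refine ⟨η₁, η₂, hη₁, hη₂, fun t => ?_⟩
  have t₁ : Tendsto (fun i => garbledPairing₁ ν (κ₁ i) t) l (𝓝 (garbledPairing₁ ν η₁ t)) :=
    h₁ _ (integrable_garbledPairing₁ ν t) t.2.1
  have t₂ : Tendsto (fun i => garbledPairing₂ μ (κ₂ i) t) l (𝓝 (garbledPairing₂ μ η₂ t)) :=
    h₂ _ (integrable_garbledPairing₂ μ t) t.2.2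
  have hn : Tendsto (fun i : Finset (ProductTest X Y₁ Y₂) × ℕ => 1 / ((i.2 : ℝ) + 1)) l (𝓝 0) :=
    (tendsto_one_div_add_atTop_nhds_zero_nat.comp
      (prod_atTop_atTop_eq (α := Finset (ProductTest X Y₁ Y₂)) (β := ℕ) ▸ tendsto_snd)).mono_left
      (Ultrafilter.of_le _)
  have hmem : ∀ᶠ i in (l : Filter (Finset (ProductTest X Y₁ Y₂) × ℕ)), t ∈ i.1 := by
    refine Ultrafilter.of_le _ ?_
    filter_upwards [eventually_ge_atTop (({t} : Finset (ProductTest X Y₁ Y₂)), 0)] with i hi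
    exact hi.1 (Finset.mem_singleton_self t)
  have hzero : Tendsto (fun i => garbledPairing₁ ν (κ₁ i) t - garbledPairing₂ μ (κ₂ i) t) l
      (𝓝 0) :=
    squeeze_zero_norm' (hmem.mono fun i hi => (h i ⟨t, hi⟩).le) hn
  exact sub_eq_zero.1 (tendsto_nhds_unique (t₁.sub t₂) hzero)

end Separation

/-- the converse lemma of the main theorem. If the information structure `μ`
is better for the maximizer than `ν` over all games in the class `G̃` (nonempty compact
metric action spaces and bounded measurable costs, continuous in the actions), then there
exist Markov kernels `κ₁ : Y₁ → Y₁` and `κ₂ : Y₂ → Y₂` such that `κ₁ν = κ₂μ`. -/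
theorem better_for_maximizer_implies_garbling
    {X Y₁ Y₂ : Type*} [MeasurableSpace X] [StandardBorelSpace X]
    [MetricSpace Y₁] [CompactSpace Y₁] [Nonempty Y₁] [MeasurableSpace Y₁] [BorelSpace Y₁]
    [MetricSpace Y₂] [CompactSpace Y₂] [Nonempty Y₂] [MeasurableSpace Y₂] [BorelSpace Y₂]
    (ζ : Measure X) [IsProbabilityMeasure ζ]
    (μ ν : Measure (X × Y₁ × Y₂)) [IsProbabilityMeasure μ] [IsProbabilityMeasure ν]
    (hμmarg : μ.map Prod.fst = ζ) (hνmarg : ν.map Prod.fst = ζ)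
    (hμac : ∃ (Q₁ : Measure Y₁) (Q₂ : Measure Y₂), IsProbabilityMeasure Q₁ ∧
      IsProbabilityMeasure Q₂ ∧ μ ≪ ζ.prod (Q₁.prod Q₂))
    (hνac : ∃ (Q₁ : Measure Y₁) (Q₂ : Measure Y₂), IsProbabilityMeasure Q₁ ∧
      IsProbabilityMeasure Q₂ ∧ ν ≪ ζ.prod (Q₁.prod Q₂))
    (hbetter : ∀ (U₁ U₂ : Type) [MetricSpace U₁] [CompactSpace U₁] [Nonempty U₁]
      [MeasurableSpace U₁] [BorelSpace U₁]
      [MetricSpace U₂] [CompactSpace U₂] [Nonempty U₂]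
      [MeasurableSpace U₂] [BorelSpace U₂],
      ∀ c : X → U₁ → U₂ → ℝ,
      (∃ M : ℝ, ∀ x u₁ u₂, |c x u₁ u₂| ≤ M) →
      (Measurable fun p : X × U₁ × U₂ => c p.1 p.2.1 p.2.2) →
      (∀ x, Continuous fun q : U₁ × U₂ => c x q.1 q.2) →
      gameValue (U₁ := U₁) (U₂ := U₂) ν c ≤ gameValue (U₁ := U₁) (U₂ := U₂) μ c) :
    ∃ (κ₁ : Kernel Y₁ Y₁) (κ₂ : Kernel Y₂ Y₂), IsMarkovKernel κ₁ ∧ IsMarkovKernel κ₂ ∧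
      ∀ (A : Set X) (B : Set Y₁) (C : Set Y₂),
        MeasurableSet A → MeasurableSet B → MeasurableSet C →
        (∫⁻ p in A ×ˢ ((Set.univ : Set Y₁) ×ˢ C), κ₁ p.2.1 B ∂ν) =
          ∫⁻ p in A ×ˢ (B ×ˢ (Set.univ : Set Y₂)), κ₂ p.2.2 C ∂μ := by
  have hB : BetterForMaximizer μ ν := hbetter
  obtain ⟨κ₁, κ₂, hκ₁, hκ₂, h⟩ := hB.exists_garbledPairing_eq
  exact ⟨κ₁, κ₂, hκ₁, hκ₂, fun A B C hA hB hC => setLIntegral_eq_of_garbledPairing_eq h hA hB hC⟩
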